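/- Let r, i, j, k ≥ 0 be integers with k ≤ r and k ≤ j, and let a, b, c, d be elements of a commutative ℚ-algebra. Then ∂^k[(aX₁+bY₁)^r · (aX₂+bY₂)^i · (cX₂+dY₂)^j] = (r!·j! / ((r−k)!·(j−k)!)) · (ad−bc)^k · (aX+bY)^{r+i−k} · (cX+dY)^{j−k}. -/

import Mathlib

open MvPolynomial

/-- The operator `∂_{X₁}∂_{Y₂} − ∂_{Y₁}∂_{X₂}` on polynomials in `X₁,Y₁,X₂,Y₂`
(variables `0,1,2,3`), over a commutative ring `R`. -/
noncomputable def Dop (R : Type*) [CommRing R] (P : MvPolynomial (Fin 4) R) :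
    MvPolynomial (Fin 4) R :=
  pderiv 0 (pderiv 3 P) - pderiv 1 (pderiv 2 P)

/-- The map `∂^k`: apply `∂_{X₁}∂_{Y₂} − ∂_{Y₁}∂_{X₂}` `k` times, then substitute
`X₁ = X₂ = X`, `Y₁ = Y₂ = Y`. -/
noncomputable def delk (R : Type*) [CommRing R] (k : ℕ) (P : MvPolynomial (Fin 4) R) :
    MvPolynomial (Fin 2) R :=
  aeval (![X 0, X 1, X 0, X 1] : Fin 4 → MvPolynomial (Fin 2) R) ((Dop R)^[k] P)

/-- The operator `Dop` commutes with multiplication by constants. -/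
lemma Dop_C_mul {R : Type*} [CommRing R] (s : R) (P : MvPolynomial (Fin 4) R) :
    Dop R (C s * P) = C s * Dop R P := by
  simp only [Dop, pderiv_C_mul, mul_sub]

/-- One application of `Dop` to a product of powers of linear forms. -/
lemma Dop_pow_mul_pow_mul_pow {R : Type*} [CommRing R] (r i j : ℕ) (a b c d : R) :
    Dop R ((C a * X 0 + C b * X 1) ^ r * (C a * X 2 + C b * X 3) ^ i *
        (C c * X 2 + C d * X 3) ^ j) =
      C ((r : R) * j * (a * d - b * c)) *
        ((C a * X 0 + C b * X 1) ^ (r - 1) * (C a * X 2 + C b * X 3) ^ i *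
          (C c * X 2 + C d * X 3) ^ (j - 1)) := by
  simp only [Dop, Derivation.leibniz, Derivation.leibniz_pow, map_add, pderiv_C, pderiv_X,
    Pi.single_apply, smul_eq_mul, nsmul_eq_mul, map_mul, map_sub, map_natCast, Fin.reduceEq,
    if_true, if_false, Derivation.map_natCast, mul_zero, mul_one, zero_add, add_zero]
  ring

/-- Iterated applications of `Dop` to a product of powers of linear forms. -/
lemma Dop_iterate_pow_mul_pow_mul_pow {R : Type*} [CommRing R] (r i j k : ℕ) (a b c d : R) :
    (Dop R)^[k] ((C a * X 0 + C b * X 1) ^ r * (C a * X 2 + C b * X 3) ^ i *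
        (C c * X 2 + C d * X 3) ^ j) =
      C ((r.descFactorial k : R) * j.descFactorial k * (a * d - b * c) ^ k) *
        ((C a * X 0 + C b * X 1) ^ (r - k) * (C a * X 2 + C b * X 3) ^ i *
          (C c * X 2 + C d * X 3) ^ (j - k)) := by
  induction k with
  | zero => simp
  | succ k ih =>
    rw [Function.iterate_succ_apply', ih, Dop_C_mul, Dop_pow_mul_pow_mul_pow, ← mul_assoc,
      ← C_mul, Nat.descFactorial_succ, Nat.descFactorial_succ, Nat.sub_sub, Nat.sub_sub]
    congr 2
    push_cast
    ring

/-- For integers `r, i, j, k ≥ 0` with `k ≤ r`, `k ≤ j`, and elements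
`a, b, c, d` of a commutative `ℚ`-algebra:
`∂^k[(aX₁+bY₁)^r (aX₂+bY₂)^i (cX₂+dY₂)^j]
  = (r!·j!/((r−k)!·(j−k)!)) (ad−bc)^k (aX+bY)^{r+i−k} (cX+dY)^{j−k}`. -/
theorem stmt_5 (A : Type*) [CommRing A] [Algebra ℚ A]
    (r i j k : ℕ) (hkr : k ≤ r) (hkj : k ≤ j) (a b c d : A) :
    delk A k ((C a * X 0 + C b * X 1) ^ r * (C a * X 2 + C b * X 3) ^ i *
        (C c * X 2 + C d * X 3) ^ j) =
      C (algebraMap ℚ A ((r.factorial * j.factorial : ℚ) /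
            (((r - k).factorial : ℚ) * ((j - k).factorial : ℚ))) * (a * d - b * c) ^ k) *
        (C a * X 0 + C b * X 1) ^ (r + i - k) * (C c * X 0 + C d * X 1) ^ (j - k) := by
  have hcoef : (r.factorial * j.factorial : ℚ) /
      (((r - k).factorial : ℚ) * ((j - k).factorial : ℚ)) =
      ((r.descFactorial k * j.descFactorial k : ℕ) : ℚ) := by
    have hr := (r - k).factorial_ne_zero
    have hj := (j - k).factorial_ne_zero
    rw [← Nat.factorial_mul_descFactorial hkr, ← Nat.factorial_mul_descFactorial hkj]
    push_cast
    field_simp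
  rw [delk, Dop_iterate_pow_mul_pow_mul_pow, hcoef, map_natCast,
    show r + i - k = (r - k) + i by omega, pow_add]
  simp [algebraMap_eq]
  ring
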